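/- Let 0 < η ≤ 1/(2|Y|) and let R ⊊ X be nonempty. Let Q_η ∈ P_η(Y) attain the pseudo-capacity C_η(W_R) = max_{r∈R} D(P_r‖Q_η), and let x ∈ X be a maximizer of x ↦ D(P_x‖Q_η) over X. Suppose there exists m̂ ∈ hull(W_R) with supp(P_x) ⊆ supp(m̂) attaining the distance to the convex hull, Δ(R,x) = χ²(P_x‖m̂) = min{χ²(P_x‖m) : m ∈ hull(W_R), supp(P_x) ⊆ supp(m)}, and let κ = min{m̂(y) : y ∈ Y, m̂(y) > 0}; assume η ≤ κ. Then the capacity loss incurred by using only the input symbols in R is bounded as C(W_X) − C(W_R) ≤ 4·|Y|·η + Δ(R,x) + √((−log η)·(C(W_R) − log κ)) · √(Δ(R,x)). -/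

import Mathlib

open scoped BigOperators Classical

/-- A probability mass function on a finite alphabet `Y`. -/
def IsPmf {Y : Type*} [Fintype Y] (p : Y → ℝ) : Prop :=
  (∀ y, 0 ≤ p y) ∧ ∑ y, p y = 1

/-- The real-valued KL sum `∑_{y : p y > 0} p y * log (p y / q y)` (natural log). -/
noncomputable def klReal {Y : Type*} [Fintype Y] (p q : Y → ℝ) : ℝ :=
  ∑ y, if 0 < p y then p y * Real.log (p y / q y) else 0

/-- KL divergence in `[0,∞] ⊆ EReal`, with the convention `D(p‖q) = ⊤`
if `supp p ⊄ supp q`. -/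
noncomputable def KL {Y : Type*} [Fintype Y] (p q : Y → ℝ) : EReal :=
  if ∀ y, 0 < p y → 0 < q y then ((klReal p q : ℝ) : EReal) else ⊤

/-- The capacity of the channel restricted to input symbols in `S`,
via the minimax (information-radius) formula, with convention `C(W_∅) = 0`. -/
noncomputable def capacity {X Y : Type*} [Fintype X] [Fintype Y]
    (P : X → Y → ℝ) (S : Set X) : EReal :=
  if S.Nonempty then
    ⨅ Q : {Q : Y → ℝ // IsPmf Q}, ⨆ x : S, KL (P (x : X)) Q.1
  else 0

/-- The pseudo-capacity: the information radius over the pseudo-simplex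
`P_η(Y) = {Q pmf : Q y ≥ η ∀ y}`, with the convention for `S = ∅` set to `0`. -/
noncomputable def pseudoCapacity {X Y : Type*} [Fintype X] [Fintype Y]
    (η : ℝ) (P : X → Y → ℝ) (S : Set X) : EReal :=
  if S.Nonempty then
    ⨅ Q : {Q : Y → ℝ // IsPmf Q ∧ ∀ y, η ≤ Q y}, ⨆ x : S, KL (P (x : X)) Q.1
  else 0

/-- The χ²-divergence `χ²(p‖q) = ∑_{y : q y > 0} (p y - q y)² / q y`. -/
noncomputable def chiSq {Y : Type*} [Fintype Y] (p q : Y → ℝ) : ℝ :=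
  ∑ y, if 0 < q y then (p y - q y) ^ 2 / q y else 0

/-- Membership in the convex hull of the rows `(P_r)_{r ∈ S}` of the channel. -/
def hullMem {X Y : Type*} [Fintype X] [Fintype Y]
    (P : X → Y → ℝ) (S : Set X) (m : Y → ℝ) : Prop :=
  ∃ c : X → ℝ, (∀ x, 0 ≤ c x) ∧ (∀ x, x ∉ S → c x = 0) ∧ (∑ x, c x) = 1 ∧
    ∀ y, m y = ∑ x, c x * P x y

lemma klReal_eq_sum {Y : Type*} [Fintype Y] {p : Y → ℝ} (hp : ∀ y, 0 ≤ p y) (q : Y → ℝ) :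
    klReal p q = ∑ y, p y * Real.log (p y / q y) := by
  unfold klReal
  refine Finset.sum_congr rfl fun y _ => ?_
  split_ifs with h
  · rfl
  · have : p y = 0 := le_antisymm (not_lt.1 h) (hp y)
    simp [this]

lemma chiSq_eq_sum {Y : Type*} [Fintype Y] (p : Y → ℝ) {q : Y → ℝ} (hq : ∀ y, 0 ≤ q y) :
    chiSq p q = ∑ y, (p y - q y) ^ 2 / q y := by
  unfold chiSq
  refine Finset.sum_congr rfl fun y _ => ?_
  split_ifs with h
  · rfl
  · have : q y = 0 := le_antisymm (not_lt.1 h) (hq y)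
    simp [this]

lemma chiSq_nonneg {Y : Type*} [Fintype Y] (p q : Y → ℝ) : 0 ≤ chiSq p q := by
  unfold chiSq
  refine Finset.sum_nonneg fun y _ => ?_
  split_ifs with h
  · positivity
  · exact le_rfl

lemma IsPmf.le_one {Y : Type*} [Fintype Y] {p : Y → ℝ} (hp : IsPmf p) (y : Y) : p y ≤ 1 :=
  hp.2 ▸ Finset.single_le_sum (fun z _ => hp.1 z) (Finset.mem_univ y)

/-- Gibbs' inequality. -/
lemma klReal_nonneg {Y : Type*} [Fintype Y] {p q : Y → ℝ} (hp : IsPmf p) (hq : IsPmf q)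
    (h : ∀ y, 0 < p y → 0 < q y) : 0 ≤ klReal p q := by
  have key : ∑ y, (p y - q y) ≤ klReal p q := by
    unfold klReal
    refine Finset.sum_le_sum fun y _ => ?_
    split_ifs with hy
    · have hqy := h y hy
      have h1 := Real.one_sub_inv_le_log_of_pos (div_pos hy hqy)
      have h2 := mul_le_mul_of_nonneg_left h1 hy.le
      have h3 : p y * (1 - (p y / q y)⁻¹) = p y - q y := by field_simp
      linarith
    · have := hq.1 y
      linarith
  rw [Finset.sum_sub_distrib, hp.2, hq.2] at key
  linarith

/-- A family of upper bounds on the divergence by the χ²-divergence, coming from the tangent of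
the logarithm at `a`. -/
lemma klReal_le_chiSq_div {Y : Type*} [Fintype Y] {p q : Y → ℝ} (hp : IsPmf p) (hq : IsPmf q)
    (h : ∀ y, 0 < p y → 0 < q y) {a : ℝ} (ha : 0 < a) :
    klReal p q ≤ (1 + chiSq p q) / a + Real.log a - 1 := by
  have key : klReal p q ≤
      ∑ y, (((p y - q y) ^ 2 / q y + 2 * p y - q y) / a + (Real.log a - 1) * p y) := by
    rw [klReal_eq_sum hp.1]
    refine Finset.sum_le_sum fun y _ => ?_
    rcases (hp.1 y).eq_or_lt with hy | hy
    · rw [← hy]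
      rcases (hq.1 y).eq_or_lt with hz | hz
      · simp [← hz]
      · have : (0 - q y) ^ 2 / q y = q y := by field_simp; ring
        rw [this]
        simp
    · have hqy := h y hy
      have h1 := Real.log_le_sub_one_of_pos (div_pos (div_pos hy hqy) ha)
      rw [Real.log_div (div_pos hy hqy).ne' ha.ne'] at h1
      have h2 : Real.log (p y / q y) ≤ p y / q y / a - 1 + Real.log a := by linarith
      refine (mul_le_mul_of_nonneg_left h2 hy.le).trans (le_of_eq ?_)
      field_simp
      ring
  refine key.trans (le_of_eq ?_)
  rw [chiSq_eq_sum p hq.1, Finset.sum_add_distrib, ← Finset.sum_div, ← Finset.mul_sum,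
    Finset.sum_sub_distrib, Finset.sum_add_distrib, ← Finset.mul_sum, hp.2, hq.2]
  ring

lemma sq_le_mul_exp_neg {f L : ℝ} (hL : 0 ≤ L) (hf : f ≤ L) :
    f ^ 2 ≤ (L + 2) * (Real.exp (-f) - 1 + f) := by
  have hpos : 0 ≤ Real.exp (-f) - 1 + f := by linarith [Real.add_one_le_exp (-f)]
  rcases le_total 0 f with h0 | h0
  · have h1 : f ^ 2 ≤ (f + 2) * (Real.exp (-f) - 1 + f) := by
      suffices 2 - f ≤ (f + 2) * Real.exp (-f) by nlinarith
      rcases lt_or_ge f 2 with h2 | h2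
      · have h3 : 0 < 2 - f := by linarith
        have h4 := Real.le_log_one_add_of_nonneg (x := 2 * f / (2 - f)) (by positivity)
        have h5 : 2 * (2 * f / (2 - f)) / (2 * f / (2 - f) + 2) = f := by
          have h : 2 * f / (2 - f) + 2 = 4 / (2 - f) := by field_simp; ring
          rw [h]; field_simp; ring
        have h6 : 1 + 2 * f / (2 - f) = (f + 2) / (2 - f) := by field_simp; ring
        rw [h5, h6, Real.le_log_iff_exp_le (by positivity), le_div_iff₀ h3] at h4
        rw [Real.exp_neg, ← div_eq_mul_inv, le_div_iff₀ (Real.exp_pos f)]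
        linarith
      · have : 0 ≤ (f + 2) * Real.exp (-f) := by positivity
        linarith
    exact h1.trans (mul_le_mul_of_nonneg_right (by linarith) hpos)
  · have h1 := Real.quadratic_le_exp_of_nonneg (x := -f) (by linarith)
    nlinarith [mul_nonneg hL hpos]

/-- The second moment of the log-likelihood ratio is controlled by its mean, when the
second argument is bounded below. -/
lemma sum_mul_log_sq_le {Y : Type*} [Fintype Y] {m q : Y → ℝ} (hm : IsPmf m) (hq : IsPmf q)
    {η : ℝ} (hη : 0 < η) (hη1 : η ≤ 1) (hqη : ∀ y, η ≤ q y) :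
    ∑ y, m y * Real.log (m y / q y) ^ 2 ≤ (-Real.log η + 2) * klReal m q := by
  have hL : 0 ≤ -Real.log η := by linarith [Real.log_nonpos hη.le hη1]
  have key : ∑ y, m y * Real.log (m y / q y) ^ 2 ≤
      ∑ y, (-Real.log η + 2) * (q y - m y + m y * Real.log (m y / q y)) := by
    refine Finset.sum_le_sum fun y _ => ?_
    have hqy : 0 < q y := hη.trans_le (hqη y)
    rcases (hm.1 y).eq_or_lt with hy | hy
    · rw [← hy]
      simp only [zero_mul, sub_zero, add_zero]
      positivity
    · have hle : Real.log (m y / q y) ≤ -Real.log η := by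
        rw [← Real.log_inv]
        refine Real.log_le_log (div_pos hy hqy) ?_
        rw [div_le_iff₀ hqy]
        calc m y ≤ 1 := hm.le_one y
          _ = η⁻¹ * η := by field_simp
          _ ≤ η⁻¹ * q y := mul_le_mul_of_nonneg_left (hqη y) (by positivity)
      have h1 := mul_le_mul_of_nonneg_left (sq_le_mul_exp_neg hL hle) hy.le
      have h2 : Real.exp (-Real.log (m y / q y)) = q y / m y := by
        rw [Real.exp_neg, Real.exp_log (div_pos hy hqy), inv_div]
      rw [h2] at h1
      refine h1.trans (le_of_eq ?_)
      field_simp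
  refine key.trans (le_of_eq ?_)
  rw [← Finset.mul_sum, Finset.sum_add_distrib, Finset.sum_sub_distrib, hm.2, hq.2,
    klReal_eq_sum hm.1]
  ring

/-- Comparison of the divergences of `p` and `m` from a third distribution `q`. -/
lemma klReal_le_add_sqrt_mul_sqrt {Y : Type*} [Fintype Y] {p m q : Y → ℝ} (hp : IsPmf p)
    (hm : IsPmf m) (hq : IsPmf q) (h : ∀ y, 0 < p y → 0 < m y)
    {η : ℝ} (hη : 0 < η) (hη1 : η ≤ 1) (hqη : ∀ y, η ≤ q y) :
    klReal p q ≤ klReal p m + klReal m q +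
      Real.sqrt (-Real.log η * klReal m q + 1) * Real.sqrt (chiSq p m) := by
  set f : Y → ℝ := fun y => Real.log (m y / q y) with hf
  set D := klReal m q with hD
  have hDf : D = ∑ y, m y * f y := klReal_eq_sum hm.1 q
  have hsplit : klReal p q = klReal p m + ∑ y, p y * f y := by
    rw [klReal_eq_sum hp.1, klReal_eq_sum hp.1, ← Finset.sum_add_distrib]
    refine Finset.sum_congr rfl fun y _ => ?_
    rcases (hp.1 y).eq_or_lt with hy | hy
    · simp [← hy]
    · have hmy := h y hy
      have hqy : 0 < q y := hη.trans_le (hqη y)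
      rw [hf, ← mul_add, ← Real.log_mul (div_pos hy hmy).ne' (div_pos hmy hqy).ne',
        div_mul_div_cancel₀ hmy.ne']
  have hcenter : ∑ y, p y * f y = D + ∑ y, (p y - m y) * (f y - D) := by
    have : ∑ y, (p y - m y) * (f y - D) =
        ∑ y, p y * f y - ∑ y, m y * f y - D * (∑ y, p y - ∑ y, m y) := by
      rw [← Finset.sum_sub_distrib, ← Finset.sum_sub_distrib, Finset.mul_sum,
        ← Finset.sum_sub_distrib]
      exact Finset.sum_congr rfl fun y _ => by ring
    rw [this, hp.2, hm.2, ← hDf]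
    ring
  have hcs : ∑ y, (p y - m y) * (f y - D) ≤
      Real.sqrt (chiSq p m) * Real.sqrt (∑ y, m y * (f y - D) ^ 2) := by
    have h1 := Real.sum_mul_le_sqrt_mul_sqrt Finset.univ
      (fun y => (p y - m y) / Real.sqrt (m y)) (fun y => Real.sqrt (m y) * (f y - D))
    have h2 : ∑ y, (p y - m y) / Real.sqrt (m y) * (Real.sqrt (m y) * (f y - D)) =
        ∑ y, (p y - m y) * (f y - D) := by
      refine Finset.sum_congr rfl fun y _ => ?_
      rcases (hm.1 y).eq_or_lt with hy | hy
      · have : p y = 0 := by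
          by_contra hne
          exact (h y (lt_of_le_of_ne (hp.1 y) (Ne.symm hne))).ne hy
        simp [← hy, this]
      · have := (Real.sqrt_pos.2 hy).ne'
        field_simp
    simp only [div_pow, mul_pow, Real.sq_sqrt (hm.1 _)] at h1
    rwa [h2, ← chiSq_eq_sum p hm.1] at h1
  have hvar : ∑ y, m y * (f y - D) ^ 2 ≤ -Real.log η * D + 1 := by
    have h1 : ∑ y, m y * (f y - D) ^ 2 =
        ∑ y, m y * f y ^ 2 - 2 * D * ∑ y, m y * f y + D ^ 2 * ∑ y, m y := by
      rw [Finset.mul_sum, Finset.mul_sum, ← Finset.sum_sub_distrib, ← Finset.sum_add_distrib]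
      exact Finset.sum_congr rfl fun y _ => by ring
    have h2 := sum_mul_log_sq_le hm hq hη hη1 hqη
    rw [h1, hm.2, ← hDf]
    nlinarith [sq_nonneg (D - 1)]
  have hsq := mul_le_mul_of_nonneg_left (Real.sqrt_le_sqrt hvar) (Real.sqrt_nonneg (chiSq p m))
  rw [hsplit, hcenter]
  linarith [mul_comm (Real.sqrt (chiSq p m)) (Real.sqrt (-Real.log η * D + 1))]

lemma hullMem.isPmf {X Y : Type*} [Fintype X] [Fintype Y] {P : X → Y → ℝ} {S : Set X}
    {m : Y → ℝ} (hm : hullMem P S m) (hP : ∀ x, IsPmf (P x)) : IsPmf m := by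
  obtain ⟨c, hc0, -, hc1, hmc⟩ := hm
  refine ⟨fun y => ?_, ?_⟩
  · rw [hmc]
    exact Finset.sum_nonneg fun x _ => mul_nonneg (hc0 x) ((hP x).1 y)
  · simp_rw [hmc]
    rw [Finset.sum_comm]
    simp_rw [← Finset.mul_sum, (hP _).2, mul_one, hc1]

/-- Divergence from a positive distribution is convex, so a bound on the rows passes to
their convex hull. -/
lemma hullMem.klReal_le {X Y : Type*} [Fintype X] [Fintype Y] {P : X → Y → ℝ} {S : Set X}
    {m : Y → ℝ} (hm : hullMem P S m) (hP : ∀ x, IsPmf (P x)) {q : Y → ℝ} (hq : ∀ y, 0 < q y)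
    {B : ℝ} (hB : ∀ x ∈ S, klReal (P x) q ≤ B) : klReal m q ≤ B := by
  have hmp := hm.isPmf hP
  obtain ⟨c, hc0, hcS, hc1, hmc⟩ := hm
  have key : klReal m q ≤ ∑ x, c x * klReal (P x) q := by
    rw [klReal_eq_sum hmp.1]
    simp_rw [fun x => klReal_eq_sum (hP x).1 q, Finset.mul_sum]
    rw [Finset.sum_comm]
    refine Finset.sum_le_sum fun y _ => ?_
    have hconv := Real.convexOn_mul_log.map_sum_le (t := Finset.univ) (w := c)
      (p := fun x => P x y / q y) (fun x _ => hc0 x) hc1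
      (fun x _ => div_nonneg ((hP x).1 y) (hq y).le)
    simp only [smul_eq_mul] at hconv
    have h1 : ∑ x, c x * (P x y / q y) = m y / q y := by
      rw [hmc, Finset.sum_div]
      exact Finset.sum_congr rfl fun x _ => by ring
    rw [h1] at hconv
    have h2 := mul_le_mul_of_nonneg_left hconv (hq y).le
    have hqy := (hq y).ne'
    have h3 : q y * (m y / q y * Real.log (m y / q y)) = m y * Real.log (m y / q y) := by
      field_simp
    rw [h3, Finset.mul_sum] at h2
    refine h2.trans (le_of_eq (Finset.sum_congr rfl fun x _ => ?_))
    field_simp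
  refine key.trans ?_
  calc ∑ x, c x * klReal (P x) q ≤ ∑ x, c x * B := by
        refine Finset.sum_le_sum fun x _ => ?_
        by_cases hx : x ∈ S
        · exact mul_le_mul_of_nonneg_left (hB x hx) (hc0 x)
        · simp [hcS x hx]
    _ = B := by rw [← Finset.sum_mul, hc1, one_mul]

lemma KL_nonneg {Y : Type*} [Fintype Y] {p q : Y → ℝ} (hp : IsPmf p) (hq : IsPmf q) :
    0 ≤ KL p q := by
  unfold KL
  split_ifs with h
  · exact_mod_cast klReal_nonneg hp hq h
  · exact le_top

lemma KL_of_pos {Y : Type*} [Fintype Y] (p : Y → ℝ) {q : Y → ℝ} (hq : ∀ y, 0 < q y) :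
    KL p q = (klReal p q : EReal) :=
  if_pos fun y _ => hq y

lemma capacity_nonneg {X Y : Type*} [Fintype X] [Fintype Y] {P : X → Y → ℝ}
    (hP : ∀ x, IsPmf (P x)) (S : Set X) : 0 ≤ capacity P S := by
  unfold capacity
  split_ifs with h
  · obtain ⟨s, hs⟩ := h
    exact le_iInf fun Q => (KL_nonneg (hP s) Q.2).trans
      (le_iSup (fun x : S => KL (P (x : X)) Q.1) ⟨s, hs⟩)
  · exact le_rfl

/-- Mixing the second argument with another measure, keeping a weight `a`, costs at most
`-log a`. -/
lemma KL_le_KL_sub_log {Y : Type*} [Fintype Y] {p q q' : Y → ℝ} (hp : IsPmf p)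
    {a : ℝ} (ha : 0 < a) (hq : ∀ y, a * q y ≤ q' y) :
    KL p q' ≤ KL p q + ((-Real.log a : ℝ) : EReal) := by
  by_cases h : ∀ y, 0 < p y → 0 < q y
  · have h' : ∀ y, 0 < p y → 0 < q' y := fun y hy => (mul_pos ha (h y hy)).trans_le (hq y)
    rw [KL, KL, if_pos h, if_pos h', ← EReal.coe_add, EReal.coe_le_coe_iff]
    have h1 : -Real.log a = ∑ y, p y * -Real.log a := by
      rw [← Finset.sum_mul, hp.2, one_mul]
    rw [klReal_eq_sum hp.1, klReal_eq_sum hp.1, h1, ← Finset.sum_add_distrib]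
    refine Finset.sum_le_sum fun y _ => ?_
    rcases (hp.1 y).eq_or_lt with hy | hy
    · simp [← hy]
    · rw [← mul_add]
      refine mul_le_mul_of_nonneg_left ?_ hy.le
      have hqy := h y hy
      have := Real.log_le_log (mul_pos ha hqy) (hq y)
      rw [Real.log_mul ha.ne' hqy.ne'] at this
      rw [Real.log_div hy.ne' hqy.ne', Real.log_div hy.ne' (h' y hy).ne']
      linarith
  · have : KL p q = ⊤ := if_neg h
    rw [this, EReal.top_add_coe]
    exact le_top

/-- Restricting the output distribution to the pseudo-simplex costs at most
`-log (1 - |Y| η)`. -/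
lemma pseudoCapacity_le {X Y : Type*} [Fintype X] [Fintype Y] {P : X → Y → ℝ}
    (hP : ∀ x, IsPmf (P x)) {η : ℝ} (hη : 0 ≤ η) (hη1 : (Fintype.card Y : ℝ) * η < 1)
    {S : Set X} (hS : S.Nonempty) :
    pseudoCapacity η P S ≤
      capacity P S + ((-Real.log (1 - (Fintype.card Y : ℝ) * η) : ℝ) : EReal) := by
  have ha : 0 < 1 - (Fintype.card Y : ℝ) * η := by linarith
  rw [← EReal.sub_le_iff_le_add (Or.inl (EReal.coe_ne_bot _)) (Or.inl (EReal.coe_ne_top _)),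
    capacity, if_pos hS]
  refine le_iInf fun Q => ?_
  rw [EReal.sub_le_iff_le_add (Or.inl (EReal.coe_ne_bot _)) (Or.inl (EReal.coe_ne_top _)),
    pseudoCapacity, if_pos hS]
  have hQ := Q.2
  let Q' : Y → ℝ := fun y => (1 - (Fintype.card Y : ℝ) * η) * Q.1 y + η
  have hQ' : IsPmf Q' ∧ ∀ y, η ≤ Q' y := by
    refine ⟨⟨fun y => ?_, ?_⟩, fun y => ?_⟩
    · exact add_nonneg (mul_nonneg ha.le (hQ.1 y)) hη
    · simp only [Q', Finset.sum_add_distrib, ← Finset.mul_sum, hQ.2, Finset.sum_const,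
        Finset.card_univ, nsmul_eq_mul]
      ring
    · exact le_add_of_nonneg_left (mul_nonneg ha.le (hQ.1 y))
  refine (iInf_le _ (⟨Q', hQ'⟩ : {Q : Y → ℝ // IsPmf Q ∧ ∀ y, η ≤ Q y})).trans ?_
  refine iSup_le fun s => ?_
  refine (KL_le_KL_sub_log (q := Q.1) (hP s) ha fun y => le_add_of_nonneg_right hη).trans ?_
  gcongr
  exact le_iSup (fun x : S => KL (P (x : X)) Q.1) s

lemma neg_log_one_sub_le {t : ℝ} (ht0 : 0 ≤ t) (ht : t ≤ 1 / 2) : -Real.log (1 - t) ≤ 2 * t := by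
  have h := Real.one_sub_inv_le_log_of_pos (show 0 < 1 - t by linarith)
  have h2 : (1 - t)⁻¹ ≤ 1 + 2 * t := by
    rw [inv_le_iff_one_le_mul₀ (by linarith)]
    nlinarith
  linarith

/-- The numerical estimate behind the capacity loss bound: here `t = |Y| η`, `κ` is the smallest
mass of the hull point and `u` its χ²-distance to the row, whose divergence is `E`. -/
lemma divergence_add_sqrt_le {n η κ C D E u : ℝ} (hn : 2 ≤ n) (hη : 0 < η)
    (ht : n * η ≤ 1 / 2) (hκ0 : 0 < κ) (hκ : κ ≤ 1 / 2) (hC : 0 ≤ C) (hu : 0 ≤ u)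
    (hD : D ≤ C - Real.log (1 - n * η))
    (hE : ∀ a, 0 < a → E ≤ (1 + u) / a + Real.log a - 1) :
    E + D + Real.sqrt (-Real.log η * D + 1) * Real.sqrt u ≤
      C + (4 * n * η + u + Real.sqrt (-Real.log η * (C - Real.log κ)) * Real.sqrt u) := by
  have ht0 : 0 < n * η := by positivity
  have hd2 := neg_log_one_sub_le ht0.le ht
  have hl2 := Real.log_two_gt_d9
  have hl2' := Real.log_two_lt_d9
  have hK : Real.log 2 ≤ -Real.log κ := by
    rw [← Real.log_inv]
    refine Real.log_le_log two_pos ?_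
    rw [le_inv_comm₀ two_pos hκ0]
    linarith
  have hE1 : E ≤ u := by
    have := hE 1 one_pos
    simp only [Real.log_one] at this
    linarith
  have hs := Real.sqrt_nonneg u
  have hL : ∀ b : ℝ, 0 < b → b * η ≤ 1 → Real.log b ≤ -Real.log η := by
    intro b hb hbη
    rw [← Real.log_inv]
    refine Real.log_le_log hb ?_
    rwa [← one_div, le_div_iff₀ hη]
  have hL4 : 2 * Real.log 2 ≤ -Real.log η := by
    have := hL (2 ^ 2) (by norm_num) (by nlinarith)
    rw [Real.log_pow] at this
    exact_mod_cast this
  set L := -Real.log η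
  set K := -Real.log κ
  have hCK : C - Real.log κ = C + K := by simp [K, sub_eq_add_neg]
  rw [hCK]
  rcases le_total (n * η) (1 / 5) with h5 | h5
  · have hL10 : 2.279 ≤ L := by
      have h1 := hL 10 (by norm_num) (by nlinarith)
      have h2 : Real.log 10 = 3 * Real.log 2 + Real.log (5 / 4) := by
        rw [show (10 : ℝ) = 2 ^ 3 * (5 / 4) by norm_num,
          Real.log_mul (by norm_num) (by norm_num), Real.log_pow]
        norm_num
      have h3 := Real.one_sub_inv_le_log_of_pos (show (0 : ℝ) < 5 / 4 by norm_num)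
      norm_num at h3
      linarith
    have hd : -Real.log (1 - n * η) ≤ 1 / 4 := by
      have h := Real.one_sub_inv_le_log_of_pos (show 0 < 1 - n * η by linarith)
      have h2 : (1 - n * η)⁻¹ ≤ 5 / 4 := by
        rw [inv_le_iff_one_le_mul₀ (by linarith)]
        linarith
      linarith
    have hV : L * D + 1 ≤ L * (C + K) := by
      have : 0.443 ≤ C + K - D := by linarith
      nlinarith
    have := mul_le_mul_of_nonneg_right (Real.sqrt_le_sqrt hV) hs
    linarith
  · have hV : L * D + 1 ≤ L * (C + K) + 1 := by
      have hd : -Real.log (1 - n * η) ≤ Real.log 2 := by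
        rw [← Real.log_inv]
        refine Real.log_le_log (inv_pos.2 (by linarith)) ?_
        rw [inv_le_comm₀ (by linarith) two_pos]
        linarith
      have : D ≤ C + K := by linarith
      nlinarith
    have hV0 : 0.49 ≤ L * (C + K) := by
      have : Real.log 2 ≤ C + K := by linarith
      nlinarith
    have h7 : 0.7 ≤ Real.sqrt (L * (C + K)) := Real.le_sqrt_of_sq_le (by linarith)
    have hsq := Real.sq_sqrt (show 0 ≤ L * (C + K) by linarith)
    have hroot : Real.sqrt (L * D + 1) ≤ Real.sqrt (L * (C + K)) + 0.53 :=
      Real.sqrt_le_iff.2 ⟨by linarith, by nlinarith⟩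
    have h8 := mul_le_mul_of_nonneg_right hroot hs
    have hE2 := hE 2 two_pos
    have husq := Real.sq_sqrt hu
    nlinarith [sq_nonneg (Real.sqrt u - 0.53)]

/-- main theorem: the capacity loss from using only input symbols in
`R ⊊ X` is bounded by `4|Y|η + Δ(R,x) + √((−log η)(C(W_R) − log κ)) √(Δ(R,x))`,
where `x` maximizes `D(P_x‖Q_η)` and `Δ(R,x)` is its χ²-distance to the convex hull
of `W_R`, attained at `m̂` with smallest positive mass `κ ≥ η`. -/
theorem capacity_loss_le_hull_distance_bound
    {X Y : Type*} [Fintype X] [Fintype Y] [Nonempty Y]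
    (P : X → Y → ℝ) (hP : ∀ x', IsPmf (P x'))
    (η : ℝ) (hη : 0 < η) (hη2 : η ≤ 1 / (2 * (Fintype.card Y : ℝ)))
    (R : Set X) (hR : R.Nonempty) (hRne : R ≠ Set.univ)
    (Qη : Y → ℝ) (hQη : IsPmf Qη) (hQηlb : ∀ y, η ≤ Qη y)
    (hQηatt : pseudoCapacity η P R = ⨆ r : R, KL (P (r : X)) Qη)
    (x : X) (hx : ∀ x', KL (P x') Qη ≤ KL (P x) Qη)
    (mhat : Y → ℝ) (hmhull : hullMem P R mhat)
    (hmsupp : ∀ y, 0 < P x y → 0 < mhat y)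
    (hmmin : ∀ m, hullMem P R m → (∀ y, 0 < P x y → 0 < m y) →
      chiSq (P x) mhat ≤ chiSq (P x) m)
    (κ : ℝ) (hκmem : ∃ y, 0 < mhat y ∧ mhat y = κ)
    (hκmin : ∀ y, 0 < mhat y → κ ≤ mhat y) (hηκ : η ≤ κ)
    (C : ℝ) (hC : capacity P R = ((C : ℝ) : EReal)) :
    capacity P Set.univ - capacity P R ≤
      ((4 * (Fintype.card Y : ℝ) * η + chiSq (P x) mhat +
        Real.sqrt ((-Real.log η) * (C - Real.log κ)) *
          Real.sqrt (chiSq (P x) mhat) : ℝ) : EReal) := by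
  set n : ℝ := (Fintype.card Y : ℝ) with hn
  have hn0 : 0 < n := by rw [hn]; exact_mod_cast Fintype.card_pos
  have hn1 : 1 ≤ n := by rw [hn]; exact_mod_cast Fintype.card_pos (α := Y)
  have ht : n * η ≤ 1 / 2 := by
    rw [le_div_iff₀ (by positivity)] at hη2
    linarith
  have hη1 : η ≤ 1 := by nlinarith
  have hQpos : ∀ y, 0 < Qη y := fun y => hη.trans_le (hQηlb y)
  have hm := hmhull.isPmf hP
  have hC0 : 0 ≤ C := by
    have := capacity_nonneg hP R
    rw [hC] at this
    exact_mod_cast this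
  have hrow : ∀ r ∈ R, klReal (P r) Qη ≤ C - Real.log (1 - n * η) := by
    intro r hr
    have h1 := pseudoCapacity_le hP hη.le (show (Fintype.card Y : ℝ) * η < 1 by linarith) hR
    rw [hQηatt, hC, ← EReal.coe_add] at h1
    have h2 := (le_iSup (fun r : R => KL (P (r : X)) Qη) ⟨r, hr⟩).trans h1
    rw [KL_of_pos _ hQpos, EReal.coe_le_coe_iff] at h2
    linarith
  have hD := hmhull.klReal_le hP hQpos hrow
  have hcomp := klReal_le_add_sqrt_mul_sqrt (hP x) hm hQη hmsupp hη hη1 hQηlb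
  have hE := fun a (ha : 0 < a) => klReal_le_chiSq_div (hP x) hm hmsupp ha
  have hreal : klReal (P x) Qη ≤ C + (4 * n * η + chiSq (P x) mhat +
      Real.sqrt ((-Real.log η) * (C - Real.log κ)) * Real.sqrt (chiSq (P x) mhat)) := by
    obtain ⟨y₀, hy₀, rfl⟩ := hκmem
    rcases le_or_gt (mhat y₀) (1 / 2) with hκ | hκ
    · have hn2 : 2 ≤ n := by
        have : 1 < Fintype.card Y := by
          by_contra hle
          have := Fintype.card_le_one_iff_subsingleton.1 (not_lt.1 hle)
          have h1 := hm.2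
          rw [Fintype.sum_subsingleton _ y₀] at h1
          linarith
        rw [hn]
        exact_mod_cast this
      exact hcomp.trans (divergence_add_sqrt_le hn2 hη ht hy₀ hκ hC0 (chiSq_nonneg _ _) hD hE)
    · have hzero : ∀ y, y ≠ y₀ → mhat y = 0 := by
        intro y hy
        by_contra hne
        have h1 := hκmin y (lt_of_le_of_ne (hm.1 y) (Ne.symm hne))
        have h2 := Finset.sum_le_sum_of_subset_of_nonneg (Finset.subset_univ {y, y₀})
          fun z _ _ => hm.1 z
        rw [Finset.sum_pair hy, hm.2] at h2
        linarith
      have hPzero : ∀ y, y ≠ y₀ → P x y = 0 := by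
        intro y hy
        by_contra hne
        exact (hmsupp y (lt_of_le_of_ne ((hP x).1 y) (Ne.symm hne))).ne' (hzero y hy)
      have hPm : P x y₀ = mhat y₀ := by
        have h1 := (hP x).2
        have h2 := hm.2
        rw [Fintype.sum_eq_single y₀ hPzero] at h1
        rw [Fintype.sum_eq_single y₀ hzero] at h2
        rw [h1, h2]
      have hchi : chiSq (P x) mhat = 0 := by
        rw [chiSq_eq_sum _ hm.1, Fintype.sum_eq_single y₀ fun y hy => by simp [hzero y hy]]
        simp [hPm]
      have hE1 := hE 1 one_pos
      have hd := neg_log_one_sub_le (by positivity) ht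
      have : 0 < n * η := by positivity
      simp only [hchi, Real.sqrt_zero, Real.log_one] at hcomp hE1 ⊢
      linarith
  have hcap : capacity P Set.univ ≤ ((klReal (P x) Qη : ℝ) : EReal) := by
    rw [capacity, if_pos ⟨x, Set.mem_univ x⟩, ← KL_of_pos _ hQpos]
    exact (iInf_le _ (⟨Qη, hQη⟩ : {Q : Y → ℝ // IsPmf Q})).trans (iSup_le fun x' => hx x')
  rw [hC, EReal.sub_le_iff_le_add (Or.inl (EReal.coe_ne_bot _)) (Or.inl (EReal.coe_ne_top _)),
    ← EReal.coe_add]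
  refine hcap.trans (EReal.coe_le_coe_iff.2 ?_)
  linarith
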